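/- arXiv:2005.07352 — 8 statements merged into one kernel-verified Lean document; each statement's English description precedes it below -/
import Mathlib

section
/- Let p be a prime, F a finite field with exactly p^r elements, and α a primitive element of F (every nonzero element of F is a power of α). Let m be a positive divisor of r. Suppose G is a finite subset of F with 0 ∈ G and |G| = p^(r−m), and suppose i is a natural number such that the set {α^i · g : g ∈ G} equals G. Then (p^r − 1)/(p^m − 1) divides i. (In particular, the least positive i with α^i · G = G is at least (p^r − 1)/(p^m − 1), which is the lower-bound content of Lemma 1.) -/
/-- Multiplication by `x` permutes the nonzero elements of a stable set, so comparing products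
over `G \ {0}` gives `x ^ (#G - 1) = 1`, that is, `x ^ #G = x`. -/
theorem pow_card_eq_self_of_image_mul_eq {F : Type*} [Field F] [DecidableEq F] {x : F}
    (hx : x ≠ 0) {G : Finset F} (hG0 : (0 : F) ∈ G) (hG : G.image (fun g => x * g) = G) :
    x ^ G.card = x := by
  have hinj : Function.Injective (fun g : F => x * g) := mul_right_injective₀ hx
  have himg : (G.erase 0).image (fun g => x * g) = G.erase 0 := by
    have h := Finset.image_erase hinj G 0
    rwa [hG, mul_zero] at h
  have hprod : ∏ g ∈ G.erase 0, g ≠ 0 :=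
    Finset.prod_ne_zero_iff.mpr fun g hg => Finset.ne_of_mem_erase hg
  have hpow : x ^ (G.erase 0).card = 1 := by
    refine mul_right_cancel₀ hprod ?_
    rw [one_mul, ← Finset.prod_const, ← Finset.prod_mul_distrib]
    conv_rhs => rw [← himg, Finset.prod_image hinj.injOn]
  rw [← Finset.card_erase_add_one hG0, pow_succ, hpow, one_mul]

/-- A nonzero element whose powers exhaust the nonzero elements of a finite field has order
one less than the cardinality of the field. -/
theorem orderOf_eq_card_sub_one_of_forall_eq_pow {F : Type*} [Field F] [Fintype F] {a : F}
    (ha : a ≠ 0) (h : ∀ x : F, x ≠ 0 → ∃ k : ℕ, x = a ^ k) :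
    orderOf a = Fintype.card F - 1 := by
  classical
  have hu : ∀ u : Fˣ, u ∈ Subgroup.zpowers (Units.mk0 a ha) := fun u => by
    obtain ⟨k, hk⟩ := h u u.ne_zero
    exact ⟨k, Units.ext (by simp [hk])⟩
  rw [← Units.val_mk0 ha, orderOf_units, orderOf_eq_card_of_forall_mem_zpowers hu,
    Nat.card_eq_fintype_card, Fintype.card_units]


/-- Lemma 1 (lower-bound content): if `G ⊆ F`, `0 ∈ G`, `|G| = p^(r-m)` and
`α^i · G = G`, then `(p^r - 1)/(p^m - 1)` divides `i`. -/
theorem stmt_0 (p r m : ℕ) (hp : p.Prime) (F : Type*) [Field F] [Fintype F]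
    [DecidableEq F]
    (hF : Fintype.card F = p ^ r) (α : F)
    (hα : ∀ x : F, x ≠ 0 → ∃ k : ℕ, x = α ^ k)
    (hm : 0 < m) (hmr : m ∣ r)
    (G : Finset F) (hG0 : (0 : F) ∈ G) (hGcard : G.card = p ^ (r - m))
    (i : ℕ) (hi : G.image (fun g => α ^ i * g) = G) :
    (p ^ r - 1) / (p ^ m - 1) ∣ i := by
  have hcard : 1 < p ^ r := hF ▸ Fintype.one_lt_card
  have hr : 0 < r := Nat.pos_of_ne_zero fun h => by simp [h] at hcard
  have hle : m ≤ r := Nat.le_of_dvd hr hmr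
  have hdvd : p ^ m - 1 ∣ p ^ r - 1 := Nat.pow_sub_one_dvd_pow_sub_one p hmr
  have hpm : 1 < p ^ m := Nat.one_lt_pow hm.ne' hp.one_lt
  rw [Nat.div_dvd_iff_dvd_mul hdvd (by omega)]
  by_cases ha : α = 0
  · have hsub : (Finset.univ : Finset F) ⊆ {0, 1} := fun x _ => by
      by_cases hx : x = 0
      · simp [hx]
      · obtain ⟨k, rfl⟩ := hα x hx
        rcases eq_or_ne k 0 with rfl | hk
        · simp
        · simp [ha, hk] at hx
    have h2 : p ^ r ≤ 2 := by
      rw [← hF, ← Finset.card_univ]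
      exact (Finset.card_le_card hsub).trans Finset.card_le_two
    rw [show p ^ r - 1 = 1 by omega]
    exact one_dvd _
  · have hx : α ^ i ≠ 0 := pow_ne_zero i ha
    have hG := pow_card_eq_self_of_image_mul_eq hx hG0 hi
    rw [hGcard] at hG
    have hq : (α ^ i) ^ p ^ m = α ^ i := by
      conv_lhs => rw [← hG]
      rw [← pow_mul, ← pow_add, Nat.sub_add_cancel hle, ← hF, FiniteField.pow_card]
    rw [← hF, ← orderOf_eq_card_sub_one_of_forall_eq_pow ha hα, orderOf_dvd_iff_pow_eq_one,
      mul_comm, pow_mul]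
    refine mul_right_cancel₀ hx ?_
    rw [← pow_succ, Nat.sub_add_cancel hpm.le, hq, one_mul]
end

section
/- Let p be a prime, F a finite field with exactly p^r elements, α a primitive element of F, and m a positive divisor of r. Then (p^r − 1)/(p^m − 1) is the least element of the set of positive natural numbers i for which there exists an additive subgroup G of F of cardinality p^(r−m) with α^i · G = G. (Lemma 1: the smallest possible α-connected set of additive subgroups of order p^(r−m) has cardinality (p^r − 1)/(p^m − 1).) -/
/-- In a finite field, an additive subgroup mapped into itself by multiplication by a nonzero
element is mapped onto itself. -/
theorem AddSubgroup.image_mul_left_eq_of_forall_mem {F : Type*} [Field F] [Finite F]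
    {G : AddSubgroup F} {b : F} (hb : b ≠ 0) (h : ∀ x ∈ G, b * x ∈ G) :
    (fun x => b * x) '' (G : Set F) = (G : Set F) := by
  refine Set.eq_of_subset_of_ncard_le ?_ ?_ (Set.toFinite _)
  · rintro _ ⟨x, hx, rfl⟩
    exact h x hx
  · rw [Set.ncard_image_of_injective _ (mul_right_injective₀ hb)]

/-- The multipliers of an additive subgroup of a finite field form a subfield. -/
def AddSubgroup.multiplierSubfield {F : Type*} [Field F] [Fintype F] (G : AddSubgroup F) :
    Subfield F where
  carrier := {a | ∀ x ∈ G, a * x ∈ G}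
  mul_mem' {a b} ha hb x hx := by
    rw [mul_assoc]
    exact ha _ (hb x hx)
  one_mem' x hx := by simpa using hx
  add_mem' {a b} ha hb x hx := by
    rw [add_mul]
    exact G.add_mem (ha x hx) (hb x hx)
  zero_mem' x _ := by simp
  neg_mem' {a} ha x hx := by
    rw [neg_mul]
    exact G.neg_mem (ha x hx)
  inv_mem' a ha x hx := by
    rcases eq_or_ne a 0 with rfl | h0
    · simp
    · have hx' : x ∈ (fun x => a * x) '' (G : Set F) := by
        rw [AddSubgroup.image_mul_left_eq_of_forall_mem h0 ha]
        exact hx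
      obtain ⟨y, hy, rfl⟩ := hx'
      simpa [h0] using hy

/-- If multiplication by `b` preserves an additive subgroup of order `p ^ (r - m)` of a field with
`p ^ r` elements, where `m ∣ r` and `m < r`, then `b ^ p ^ m = b`. -/
theorem pow_prime_pow_eq_self_of_forall_mul_mem {p r m : ℕ} (hp : p.Prime) {F : Type*} [Field F]
    [Fintype F] (hF : Fintype.card F = p ^ r) (hmr : m < r) {G : AddSubgroup F}
    (hG : Nat.card G = p ^ (r - m)) {b : F} (hb : ∀ x ∈ G, b * x ∈ G) : b ^ p ^ m = b := by
  classical
  let K := G.multiplierSubfield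
  let V : Submodule K F := { G with smul_mem' := fun c x hx => c.2 x hx }
  have hV : Nat.card V = p ^ (r - m) := hG
  have hFK : Nat.card F = Nat.card K ^ Module.finrank K F := Module.natCard_eq_pow_finrank
  have hVK : Nat.card V = Nat.card K ^ Module.finrank K V := Module.natCard_eq_pow_finrank
  rw [Nat.card_eq_fintype_card, hF] at hFK
  rw [hV] at hVK
  have hpos : Module.finrank K F ≠ 0 := Module.finrank_pos.ne'
  obtain ⟨d, -, hd⟩ := (Nat.dvd_prime_pow hp).1 (hFK ▸ dvd_pow_self (Nat.card K) hpos)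
  rw [hd, ← pow_mul] at hFK hVK
  have h1 : d ∣ r := ⟨_, Nat.pow_right_injective hp.two_le hFK⟩
  have h2 : d ∣ r - m := ⟨_, Nat.pow_right_injective hp.two_le hVK⟩
  obtain ⟨e, rfl⟩ : d ∣ m := (Nat.dvd_sub_iff_right hmr.le h1).1 h2
  have h3 := FiniteField.pow_card_pow (K := K) e ⟨b, hb⟩
  rw [← Nat.card_eq_fintype_card, hd, ← pow_mul] at h3
  exact congrArg Subtype.val h3

/-- If `q - 1` divides `|F| - 1`, the field `F` has exactly `q` solutions of `x ^ q = x`. -/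
theorem FiniteField.ncard_pow_eq_self {F : Type*} [Field F] [Fintype F] {q : ℕ} (hq : 0 < q)
    (h : q - 1 ∣ Fintype.card F - 1) : {x : F | x ^ q = x}.ncard = q := by
  have hset : {x : F | x ^ q = x} =
      insert 0 (Units.val '' ((powMonoidHom (q - 1) : Fˣ →* Fˣ).ker : Set Fˣ)) := by
    ext x
    rcases eq_or_ne x 0 with rfl | hx
    · simp [hq.ne']
    · lift x to Fˣ using hx.isUnit
      have : (x : F) ^ q = x ↔ (x : F) ^ (q - 1) = 1 := by
        conv_lhs => rw [← Nat.sub_add_cancel hq, pow_succ]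
        simp
      rw [Set.mem_ofPred_eq, this, Set.mem_insert_iff, or_iff_right hx,
        Units.val_injective.mem_set_image, SetLike.mem_coe, MonoidHom.mem_ker, Units.ext_iff]
      simp
  rw [hset, Set.ncard_insert_of_notMem (by simp) (Set.toFinite _),
    Set.ncard_image_of_injective _ Units.val_injective, ← Nat.card_coe_set_eq]
  have := IsCyclic.card_powMonoidHom_ker Fˣ (q - 1)
  rw [Nat.card_units, Nat.card_eq_fintype_card (α := F), Nat.gcd_eq_right h] at this
  change Nat.card (powMonoidHom (q - 1) : Fˣ →* Fˣ).ker + 1 = q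
  omega

/-- A field with `p ^ r` elements has, for `m ∣ r`, an additive subgroup of order `p ^ (r - m)`
preserved by multiplication by every `b` with `b ^ p ^ m = b`. -/
theorem exists_addSubgroup_forall_mul_mem {p r m : ℕ} (hp : p.Prime) {F : Type*} [Field F]
    [Fintype F] (hF : Fintype.card F = p ^ r) (hr : r ≠ 0) (hmr : m ∣ r) :
    ∃ G : AddSubgroup F, Nat.card G = p ^ (r - m) ∧
      ∀ b : F, b ^ p ^ m = b → ∀ x ∈ G, b * x ∈ G := by
  have := Fact.mk hp
  have : CharP F p := charP_of_card_eq_prime_pow hF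
  let f : F →+ F := (iterateFrobenius F p m : F →+ F) - AddMonoidHom.id F
  have hf (x : F) : f x = x ^ p ^ m - x := rfl
  have hker : Nat.card f.ker = p ^ m := by
    have h := FiniteField.ncard_pow_eq_self (F := F) (pow_pos hp.pos m)
      (by rw [hF]; exact Nat.pow_sub_one_dvd_pow_sub_one p hmr)
    rw [← Nat.card_coe_set_eq] at h
    convert h using 4 with x
    simp [AddMonoidHom.mem_ker, hf, sub_eq_zero]
  refine ⟨f.range, ?_, ?_⟩
  · have h := f.ker.card_mul_index
    rw [AddSubgroup.index_ker, hker, Nat.card_eq_fintype_card (α := F), hF] at h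
    apply Nat.eq_of_mul_eq_mul_left (pow_pos hp.pos m)
    rw [h, ← pow_add, Nat.add_sub_cancel' (Nat.le_of_dvd (Nat.pos_of_ne_zero hr) hmr)]
  · rintro b hb _ ⟨x, rfl⟩
    exact ⟨b * x, by rw [hf, hf, mul_pow, hb]; ring⟩


/-- Lemma 1: `(p^r - 1)/(p^m - 1)` is the least positive `i` such that some
additive subgroup `G` of `F` of order `p^(r-m)` satisfies `α^i · G = G`. -/
theorem stmt_1 (p r m : ℕ) (hp : p.Prime) (F : Type*) [Field F] [Fintype F]
    (hF : Fintype.card F = p ^ r) (α : F)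
    (hα : ∀ x : F, x ≠ 0 → ∃ k : ℕ, x = α ^ k)
    (hm : 0 < m) (hmr : m ∣ r) :
    IsLeast {i : ℕ | 0 < i ∧ ∃ G : AddSubgroup F, Nat.card G = p ^ (r - m) ∧
      (fun x => α ^ i * x) '' (G : Set F) = (G : Set F)}
      ((p ^ r - 1) / (p ^ m - 1)) := by
  have hr : r ≠ 0 := by
    rintro rfl
    have := Fintype.one_lt_card (α := F)
    simp [hF] at this
  have hq : 0 < p ^ m - 1 := Nat.sub_pos_of_lt (Nat.one_lt_pow hm.ne' hp.one_lt)
  have hdvd := Nat.pow_sub_one_dvd_pow_sub_one p hmr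
  have hQ : 0 < p ^ r - 1 := Nat.sub_pos_of_lt (Nat.one_lt_pow hr hp.one_lt)
  rcases (Nat.le_of_dvd (Nat.pos_of_ne_zero hr) hmr).eq_or_lt with rfl | hlt
  · rw [Nat.div_self hq]
    refine ⟨⟨one_pos, ⊥, by simp, by simp⟩, fun i hi => hi.1⟩
  have hα0 : α ≠ 0 := by
    rintro rfl
    have h1 (x : F) (hx : x ≠ 0) : x = 1 := by
      obtain ⟨k, rfl⟩ := hα x hx
      rcases k with _ | k <;> simp_all
    have h2 : Fintype.card F ≤ 2 := by
      classical
      rw [← Finset.card_univ]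
      refine (Finset.card_le_card (t := {0, 1}) fun x _ => ?_).trans Finset.card_le_two
      by_cases hx : x = 0 <;> simp_all
    have h3 : p ^ 1 < p ^ r := Nat.pow_lt_pow_right hp.one_lt (by omega)
    rw [pow_one, ← hF] at h3
    have := hp.two_le
    omega
  have hord : orderOf α = p ^ r - 1 := by
    have h := orderOf_eq_card_of_forall_mem_powers (g := Units.mk0 α hα0) fun x => by
      obtain ⟨k, hk⟩ := hα x x.ne_zero
      exact ⟨k, Units.ext (by simp [hk])⟩
    rwa [← orderOf_units, Units.val_mk0, Nat.card_units, Nat.card_eq_fintype_card, hF] at h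
  have hpow : p ^ m = (p ^ m - 1) + 1 := by omega
  refine ⟨⟨Nat.div_pos (Nat.le_of_dvd hQ hdvd) hq, ?_⟩, ?_⟩
  · obtain ⟨G, hG, hmul⟩ := exists_addSubgroup_forall_mul_mem hp hF hr hmr
    refine ⟨G, hG, AddSubgroup.image_mul_left_eq_of_forall_mem (pow_ne_zero _ hα0) (hmul _ ?_)⟩
    rw [hpow, pow_succ, Nat.add_sub_cancel, ← pow_mul, Nat.div_mul_cancel hdvd, ← hord,
      pow_orderOf_eq_one, one_mul]
  · rintro i ⟨hi, G, hG, himg⟩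
    have h := pow_prime_pow_eq_self_of_forall_mul_mem hp hF hlt hG (b := α ^ i)
      fun x hx => himg.subset ⟨x, hx, rfl⟩
    rw [hpow, pow_succ, mul_eq_right₀ (pow_ne_zero _ hα0), ← pow_mul,
      ← orderOf_dvd_iff_pow_eq_one, hord] at h
    exact Nat.div_le_of_le_mul (mul_comm i _ ▸ Nat.le_of_dvd (Nat.mul_pos hi hq) h)
end

section
/- Let F be a finite field, let c be a nonzero element of F, and let G be a finite subset of F with 0 ∈ G such that c · G = G (as sets). Then the multiplicative order of c divides |G| − 1. -/
/-- In a finite group, the order of `u` divides the cardinality of every set stable under right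
multiplication by `u`. -/
theorem orderOf_dvd_natCard_of_mul_right_mem {Γ : Type*} [Group Γ] [Finite Γ] (u : Γ) (s : Set Γ)
    (hs : ∀ a ∈ s, a * u ∈ s) : orderOf u ∣ Nat.card s := by
  have hpow (a : Γ) (ha : a ∈ s) (n : ℕ) : a * u ^ n ∈ s := by
    induction n with
    | zero => simpa using ha
    | succ n ih => simpa only [pow_succ, mul_assoc] using hs _ ih
  let q : Γ → Γ ⧸ Subgroup.zpowers u := QuotientGroup.mk
  have hsat : q ⁻¹' (q '' s) = s := by
    refine Set.Subset.antisymm ?_ (Set.subset_preimage_image q s)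
    rintro a ⟨b, hb, hab⟩
    have hmem : b⁻¹ * a ∈ Subgroup.zpowers u := QuotientGroup.eq.mp hab
    obtain ⟨n, hn⟩ := mem_powers_iff_mem_zpowers.mpr hmem
    have han : a = b * u ^ n := eq_mul_of_inv_mul_eq hn.symm
    exact han ▸ hpow b hb n
  have hcard := Nat.card_congr
    (QuotientGroup.preimageMkEquivSubgroupProdSet (Subgroup.zpowers u) (q '' s))
  rw [Nat.card_prod, Nat.card_zpowers] at hcard
  rw [← hsat]
  exact ⟨_, hcard⟩

/-- If `c ≠ 0`, `G ⊆ F` is finite with `0 ∈ G` and `c · G = G`, then the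
multiplicative order of `c` divides `|G| - 1`. -/
theorem stmt_2 (F : Type*) [Field F] [Fintype F] [DecidableEq F]
    (c : F) (hc : c ≠ 0)
    (G : Finset F) (hG0 : (0 : F) ∈ G)
    (hG : G.image (fun g => c * g) = G) :
    orderOf c ∣ G.card - 1 := by
  let u : Fˣ := Units.mk0 c hc
  let s : Set Fˣ := {a | (a : F) ∈ G}
  have hs : ∀ a ∈ s, a * u ∈ s := fun a ha => by
    have hmem : c * (a : F) ∈ G := hG ▸ Finset.mem_image_of_mem (fun g => c * g) ha
    simpa [s, u, mul_comm] using hmem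
  have himage : Units.val '' s = (G.erase 0 : Set F) := by
    ext x
    constructor
    · rintro ⟨a, ha, rfl⟩
      exact Finset.mem_coe.mpr (Finset.mem_erase.mpr ⟨a.ne_zero, ha⟩)
    · intro hx
      obtain ⟨hx0, hxG⟩ := Finset.mem_erase.mp (Finset.mem_coe.mp hx)
      exact ⟨Units.mk0 x hx0, hxG, rfl⟩
  have hcard : Nat.card s = G.card - 1 := by
    rw [← Finset.card_erase_of_mem hG0, ← Set.ncard_coe_finset, ← himage,
      Set.ncard_image_of_injective s Units.val_injective, Nat.card_coe_set_eq]
  have hdvd := orderOf_dvd_natCard_of_mul_right_mem u s hs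
  rwa [hcard, ← orderOf_units] at hdvd
end

section
/- Let p be a prime, F a finite field with exactly p^r elements, K a subfield of F with exactly p^m elements (m a divisor of r), and ψ : F → K a surjective K-linear map (F regarded as a K-vector space; the paper's constant-coefficient homomorphism ψ* is such a map). Then for every nonzero c ∈ F, the set c · ker(ψ) equals ker(ψ) if and only if c ∈ K. (This is the key stabilizer claim in the proof of Lemma 4.) -/
/-- If multiplication by `c` preserves the kernel of a surjective `K`-linear map `ψ : F → K`,
then `c` lies in the subfield `K`. -/
theorem Subfield.mem_of_forall_map_mul_eq_zero {F : Type*} [Field F] {K : Subfield F}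
    {ψ : F →ₗ[K] K} (hψ : Function.Surjective ψ) {c : F}
    (hc : ∀ x, ψ x = 0 → ψ (c * x) = 0) : c ∈ K := by
  obtain ⟨u, hu⟩ := hψ 1
  have hmul (x : F) : ψ (c * x) = ψ (c * u) * ψ x := by
    have h := hc (x - ψ x • u) (by simp [hu])
    rw [mul_sub, mul_smul_comm, map_sub, map_smul, sub_eq_zero, smul_eq_mul] at h
    rw [h, mul_comm]
  have hzero (x : F) : ψ ((c - (ψ (c * u) : F)) * x) = 0 := by
    rw [sub_mul, map_sub, hmul, sub_eq_zero]
    exact (ψ.map_smul (ψ (c * u)) x).symm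
  by_contra hcK
  have hne : c - (ψ (c * u) : F) ≠ 0 := fun h => hcK (sub_eq_zero.mp h ▸ (ψ (c * u)).2)
  have h := hzero ((c - (ψ (c * u) : F))⁻¹ * u)
  rw [mul_inv_cancel_left₀ hne, hu] at h
  exact one_ne_zero h

/-- Stabilizer claim from Lemma 4: for a surjective `K`-linear map `ψ : F → K`
(`K` a subfield of `F` with `p^m` elements) and nonzero `c ∈ F`, one has
`c · ker ψ = ker ψ` iff `c ∈ K`. -/
theorem stmt_7 (p r m : ℕ) (hp : p.Prime) (F : Type*) [Field F] [Fintype F]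
    (hF : Fintype.card F = p ^ r)
    (hm : 0 < m) (hmr : m ∣ r)
    (K : Subfield F) (hK : Nat.card K = p ^ m)
    (ψ : F →ₗ[K] K) (hψ : Function.Surjective ψ) :
    ∀ c : F, c ≠ 0 →
      ((fun x => c * x) '' {x : F | ψ x = 0} = {x : F | ψ x = 0} ↔ c ∈ K) := by
  intro c hc
  constructor
  · intro h
    refine Subfield.mem_of_forall_map_mul_eq_zero hψ fun x hx => ?_
    exact h.subset ⟨x, hx, rfl⟩
  · intro hcK
    have hmul (a : F) (ha : a ∈ K) (x : F) : ψ (a * x) = ⟨a, ha⟩ * ψ x :=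
      ψ.map_smul ⟨a, ha⟩ x
    ext x
    constructor
    · rintro ⟨y, hy, rfl⟩
      rw [Set.mem_ofPred_eq] at hy
      simp [hmul c hcK, hy]
    · intro hx
      rw [Set.mem_ofPred_eq] at hx
      exact ⟨c⁻¹ * x, by simp [hmul _ (K.inv_mem hcK), hx], mul_inv_cancel_left₀ hc x⟩
end

section
/- Let p be a prime, F a finite field with exactly p^r elements, α a primitive element of F, K a subfield of F with exactly p^m elements (m a divisor of r), and ψ : F → K a surjective K-linear map. Then (p^r − 1)/(p^m − 1) is the least positive natural number i such that α^i · ker(ψ) = ker(ψ). (Lemma 4: the kernels α^i · ker(ψ) form an α-connected set of additive subgroups of order p^(r−m) of the minimum cardinality (p^r − 1)/(p^m − 1).) -/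
open Polynomial in
theorem Subfield.mem_iff_pow_natCard_eq_self {F : Type*} [Field F] (K : Subfield F) [Finite K]
    {x : F} : x ∈ K ↔ x ^ Nat.card K = x := by
  have := Fintype.ofFinite K
  have hroots : (X ^ Nat.card K - X : K[X]).roots = Finset.univ.val := by
    rw [Nat.card_eq_fintype_card]
    exact FiniteField.roots_X_pow_card_sub_X _
  have hmap := hroots ▸
    (Polynomial.splits_X_pow_nat_card_sub_X (K := K)).roots_map K.subtype ▸
      Multiset.mem_map (b := x)
  have hne : (X ^ Nat.card K - X : F[X]) ≠ 0 :=
    FiniteField.X_pow_card_sub_X_ne_zero F Finite.one_lt_card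
  simpa [-Nat.card_eq_fintype_card, hne, sub_eq_zero, iff_comm] using hmap

theorem LinearMap.image_mul_ker_eq_iff_mem {F : Type*} [Field F] (K : Subfield F)
    (ψ : F →ₗ[K] K) (hψ : Function.Surjective ψ) {c : F} (hc : c ≠ 0) :
    (fun x => c * x) '' {x : F | ψ x = 0} = {x : F | ψ x = 0} ↔ c ∈ K := by
  have hsmul (k : K) (x : F) : ψ ((k : F) * x) = k * ψ x := ψ.map_smul k x
  constructor
  · intro h
    obtain ⟨u, hu⟩ := hψ 1
    have hker (x : F) (hx : ψ x = 0) : ψ (c * x) = 0 := by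
      have : c * x ∈ {x : F | ψ x = 0} := h ▸ Set.mem_image_of_mem _ hx
      exact this
    have hscalar (x : F) : ψ ((c - ψ (c * u)) * x) = 0 := by
      have hx := hker (x - (ψ x : F) * u) (by rw [map_sub, hsmul, hu, mul_one, sub_self])
      rw [mul_sub, mul_left_comm, map_sub, hsmul] at hx
      rw [sub_mul, map_sub, hsmul, mul_comm (ψ (c * u)), hx]
    by_contra hcK
    have hne : c - ψ (c * u) ≠ 0 := fun h0 => hcK (sub_eq_zero.mp h0 ▸ (ψ (c * u)).2)
    have := hscalar ((c - ψ (c * u))⁻¹ * u)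
    rw [mul_inv_cancel_left₀ hne, hu] at this
    exact one_ne_zero this
  · intro hcK
    have hmul (x : F) : ψ (c * x) = ⟨c, hcK⟩ * ψ x := hsmul ⟨c, hcK⟩ x
    have hcK0 : (⟨c, hcK⟩ : K) ≠ 0 := fun h => hc (congrArg Subtype.val h)
    ext y
    constructor
    · rintro ⟨x, hx, rfl⟩
      change ψ x = 0 at hx
      change ψ (c * x) = 0
      rw [hmul, hx, mul_zero]
    · intro (hy : ψ y = 0)
      refine ⟨c⁻¹ * y, ?_, mul_inv_cancel_left₀ hc y⟩
      have h := hmul (c⁻¹ * y)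
      rw [mul_inv_cancel_left₀ hc, hy] at h
      exact (mul_eq_zero.mp h.symm).resolve_left hcK0

theorem orderOf_eq_natCard_sub_one_of_forall_eq_pow {F : Type*} [Field F] [Finite F] {α : F}
    (hα0 : α ≠ 0) (hα : ∀ x : F, x ≠ 0 → ∃ k : ℕ, x = α ^ k) :
    orderOf α = Nat.card F - 1 := by
  rw [← Nat.card_units, ← Units.val_mk0 hα0, orderOf_units]
  refine orderOf_eq_card_of_forall_mem_powers fun x => ?_
  obtain ⟨k, hk⟩ := hα x x.ne_zero
  exact ⟨k, Units.ext (by simp [hk])⟩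

theorem pow_mem_subfield_iff_dvd {F : Type*} [Field F] [Finite F] {α : F}
    (hα0 : α ≠ 0) (hα : ∀ x : F, x ≠ 0 → ∃ k : ℕ, x = α ^ k) (K : Subfield F)
    {N : ℕ} (hN : Nat.card F - 1 = N * (Nat.card K - 1)) (i : ℕ) :
    α ^ i ∈ K ↔ N ∣ i := by
  have hK : 1 < Nat.card K := Finite.one_lt_card
  have hpos : 0 < Nat.card K - 1 := Nat.sub_pos_of_lt hK
  rw [K.mem_iff_pow_natCard_eq_self, ← Nat.mul_dvd_mul_iff_right hpos, ← hN,
    ← orderOf_eq_natCard_sub_one_of_forall_eq_pow hα0 hα, orderOf_dvd_iff_pow_eq_one, pow_mul]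
  conv_lhs => rw [← Nat.sub_add_cancel hK.le, pow_succ]
  exact mul_eq_right₀ (pow_ne_zero i hα0)

/-- Lemma 4: `(p^r - 1)/(p^m - 1)` is the least positive `i` such that
`α^i · ker ψ = ker ψ`, where `ψ : F → K` is a surjective `K`-linear map. -/
theorem stmt_8 (p r m : ℕ) (hp : p.Prime) (F : Type*) [Field F] [Fintype F]
    (hF : Fintype.card F = p ^ r) (α : F)
    (hα : ∀ x : F, x ≠ 0 → ∃ k : ℕ, x = α ^ k)
    (hm : 0 < m) (hmr : m ∣ r)
    (K : Subfield F) (hK : Nat.card K = p ^ m)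
    (ψ : F →ₗ[K] K) (hψ : Function.Surjective ψ) :
    IsLeast {i : ℕ | 0 < i ∧
        (fun x => α ^ i * x) '' {x : F | ψ x = 0} = {x : F | ψ x = 0}}
      ((p ^ r - 1) / (p ^ m - 1)) := by
  have hcard : Nat.card F = p ^ r := by rw [Nat.card_eq_fintype_card, hF]
  have hone : 1 < p ^ r := hcard ▸ Finite.one_lt_card
  have hq : 1 < p ^ m := hK ▸ Finite.one_lt_card
  have hdvd : p ^ m - 1 ∣ p ^ r - 1 := Nat.pow_sub_one_dvd_pow_sub_one p hmr
  have hNpos : 0 < (p ^ r - 1) / (p ^ m - 1) :=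
    Nat.div_pos (Nat.le_of_dvd (by omega) hdvd) (by omega)
  have hiff (hα0 : α ≠ 0) (i : ℕ) :
      (fun x => α ^ i * x) '' {x : F | ψ x = 0} = {x : F | ψ x = 0} ↔
      (p ^ r - 1) / (p ^ m - 1) ∣ i := by
    rw [LinearMap.image_mul_ker_eq_iff_mem K ψ hψ (pow_ne_zero i hα0)]
    exact pow_mem_subfield_iff_dvd hα0 hα K (by rw [hcard, hK, Nat.div_mul_cancel hdvd]) i
  rcases eq_or_ne α 0 with rfl | hα0
  · -- `0` generates the nonzero elements only in the field with two elements
    have hF2 (x : F) (hx : x ≠ 0) : x = 1 := by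
      obtain ⟨k, rfl⟩ := hα x hx
      cases k with
      | zero => exact pow_zero _
      | succ k => exact absurd (zero_pow k.succ_ne_zero) hx
    have hker : {x : F | ψ x = 0} = {0} := by
      ext x
      refine ⟨fun (hx : ψ x = 0) => by_contra fun hx0 => ?_, fun hx => by simp_all⟩
      obtain ⟨u, hu⟩ := hψ 1
      have hu0 : u ≠ 0 := by
        rintro rfl
        simp at hu
      rw [hF2 u hu0, ← hF2 x hx0, hx] at hu
      exact zero_ne_one hu
    have hle : p ^ r ≤ 2 := by
      classical
      rw [← hF, ← Finset.card_univ]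
      refine (Finset.card_le_card fun x _ => ?_).trans (Finset.card_le_two (a := (0 : F)) (b := 1))
      by_cases hx : x = 0
      · simp [hx]
      · simp [hF2 x hx]
    have hN : (p ^ r - 1) / (p ^ m - 1) = 1 :=
      le_antisymm ((Nat.div_le_self _ _).trans (by omega)) hNpos
    rw [hN, hker]
    exact ⟨⟨one_pos, by simp⟩, fun i hi => hi.1⟩
  · exact ⟨⟨hNpos, (hiff hα0 _).2 dvd_rfl⟩, fun i hi => Nat.le_of_dvd hi.1 ((hiff hα0 i).1 hi.2)⟩
end

section
/- Let p be a prime, F a finite field with exactly p^r elements, α a primitive element of F, K a subfield of F with exactly p^m elements (m a divisor of r), and ψ : F → K a surjective K-linear map. Then the number of distinct subsets of F of the form α^i · ker(ψ), as i ranges over the natural numbers, is exactly (p^r − 1)/(p^m − 1). -/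
open scoped Pointwise

/-- A scalar preserving the kernel of a surjective functional `ψ : F → K` lies in `K`. -/
theorem mem_of_forall_mul_mem_ker {F : Type*} [Field F] {K : Subfield F} {ψ : F →ₗ[K] K}
    (hψ : Function.Surjective ψ) {u : F} (hu : ∀ x, ψ x = 0 → ψ (u * x) = 0) : u ∈ K := by
  obtain ⟨e, he⟩ := hψ 1
  have key : ∀ x : F, ψ ((u - ψ (u * e)) * x) = 0 := by
    intro x
    have h1 : ψ (x - ψ x • e) = 0 := by simp [he]
    have h2 := hu _ h1
    rw [mul_sub, mul_smul_comm, map_sub, map_smul, sub_eq_zero, smul_eq_mul] at h2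
    have h3 : ((ψ (u * e) : K) : F) * x = ψ (u * e) • x := rfl
    rw [sub_mul, map_sub, h3, map_smul, h2, smul_eq_mul, mul_comm, sub_self]
  by_cases h : u - ψ (u * e) = 0
  · rw [sub_eq_zero.mp h]
    exact (ψ (u * e)).2
  · have h1 := key ((u - ψ (u * e))⁻¹ * e)
    rw [mul_inv_cancel_left₀ h, he] at h1
    exact absurd h1 one_ne_zero

/-- The stabilizer of the kernel of a surjective functional `ψ : F → K` is `Kˣ`. -/
theorem stabilizer_ker_eq_range {F : Type*} [Field F] {K : Subfield F} {ψ : F →ₗ[K] K}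
    (hψ : Function.Surjective ψ) :
    MulAction.stabilizer Fˣ {x : F | ψ x = 0} = (Units.map (K.subtype : K →* F)).range := by
  ext u
  rw [MulAction.mem_stabilizer_iff]
  constructor
  · intro h
    have hu : (u : F) ∈ K := by
      refine mem_of_forall_mul_mem_ker hψ fun x hx => ?_
      have h1 : u • x ∈ {x : F | ψ x = 0} := by
        rw [← h]
        exact Set.smul_mem_smul_set hx
      exact h1
    refine ⟨Units.mk0 ⟨u, hu⟩ fun h0 => u.ne_zero (congrArg Subtype.val h0), ?_⟩
    ext
    rfl
  · rintro ⟨c, rfl⟩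
    ext x
    rw [Set.mem_smul_set_iff_inv_smul_mem, ← map_inv]
    have h1 : (Units.map (K.subtype : K →* F) c⁻¹) • x = ((c⁻¹ : Kˣ) : K) • x := rfl
    rw [Set.mem_ofPred_eq, Set.mem_ofPred_eq, h1, map_smul, smul_eq_mul, Units.mul_right_eq_zero]

/-- The translates of `ker ψ` by powers of a primitive element form an orbit of `Fˣ`. -/
theorem setOf_pow_mul_ker_eq_orbit {F : Type*} [Field F] {α : F}
    (hα : ∀ x : F, x ≠ 0 → ∃ k : ℕ, x = α ^ k) {K : Subfield F} {ψ : F →ₗ[K] K}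
    (hψ : Function.Surjective ψ) :
    {S : Set F | ∃ i : ℕ, S = (fun x => α ^ i * x) '' {x : F | ψ x = 0}}
      = MulAction.orbit Fˣ {x : F | ψ x = 0} := by
  ext S
  constructor
  · rintro ⟨i, rfl⟩
    by_cases h0 : α ^ i = 0
    · have hα0 : α = 0 := eq_zero_of_pow_eq_zero h0
      have h1 : ∀ x : F, x ≠ 0 → x = 1 := by
        intro x hx
        obtain ⟨k, rfl⟩ := hα x hx
        rcases k with _ | k
        · exact pow_zero α
        · simp [hα0] at hx
      have hker : {x : F | ψ x = 0} = {0} := by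
        ext x
        refine ⟨fun hx => ?_, fun hx => ?_⟩
        · by_contra hne
          obtain ⟨e, he⟩ := hψ 1
          have he0 : e ≠ 0 := by
            rintro rfl
            simp at he
          rw [h1 e he0, ← h1 x hne, hx] at he
          exact zero_ne_one he
        · rw [Set.mem_singleton_iff.mp hx]
          exact map_zero ψ
      exact ⟨1, by simp [hker]⟩
    · exact ⟨Units.mk0 _ h0, rfl⟩
  · rintro ⟨u, rfl⟩
    obtain ⟨k, hk⟩ := hα u u.ne_zero
    exact ⟨k, by rw [← hk]; rfl⟩

/-- The number of distinct subsets of `F` of the form `α^i · ker ψ` is exactly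
`(p^r - 1)/(p^m - 1)`. -/
theorem stmt_9 (p r m : ℕ) (hp : p.Prime) (F : Type*) [Field F] [Fintype F]
    (hF : Fintype.card F = p ^ r) (α : F)
    (hα : ∀ x : F, x ≠ 0 → ∃ k : ℕ, x = α ^ k)
    (hm : 0 < m) (hmr : m ∣ r)
    (K : Subfield F) (hK : Nat.card K = p ^ m)
    (ψ : F →ₗ[K] K) (hψ : Function.Surjective ψ) :
    Nat.card {S : Set F | ∃ i : ℕ, S = (fun x => α ^ i * x) '' {x : F | ψ x = 0}}
      = (p ^ r - 1) / (p ^ m - 1) := by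
  have hcard : Nat.card (MulAction.stabilizer Fˣ {x : F | ψ x = 0}) = p ^ m - 1 := by
    rw [stabilizer_ker_eq_range hψ, ← hK, ← Nat.card_units]
    exact Nat.card_range_of_injective (Units.map_injective K.subtype.injective)
  have hmul := (MulAction.stabilizer Fˣ {x : F | ψ x = 0}).card_mul_index
  rw [hcard, Nat.card_units, Nat.card_eq_fintype_card, hF, MulAction.index_stabilizer] at hmul
  have hpos : 0 < p ^ m - 1 := Nat.sub_pos_of_lt (Nat.one_lt_pow hm.ne' hp.one_lt)
  rw [setOf_pow_mul_ker_eq_orbit hα hψ, Nat.card_coe_set_eq, ← hmul,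
    Nat.mul_div_cancel_left _ hpos]
end

section
/- Let p be a prime, F a finite field with exactly p^r elements, α a primitive element of F, K a subfield of F with exactly p^m elements (m a divisor of r), and ψ : F → K a surjective K-linear map. Set N = (p^r − 1)/(p^m − 1). Then the K-linear map from F to K^N sending x to the vector (ψ(α^(−i)·x)) for i = 0, 1, …, N−1 is injective; equivalently, if x ∈ F satisfies ψ(α^(−i)·x) = 0 for all 0 ≤ i < N, then x = 0. (The alternate representation of F-symbols as length-N vectors over K is unique.) -/
/-- An element of a finite field fixed by `x ↦ x ^ #K` lies in the subfield `K`. -/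
theorem Subfield.mem_of_pow_card_eq_self {F : Type*} [Field F] [Finite F] (K : Subfield F)
    {x : F} (hx : x ^ Nat.card K = x) : x ∈ K := by
  classical
  have := Fintype.ofFinite F
  have hq : 1 < Nat.card K := Finite.one_lt_card
  by_contra hxK
  have hroots : (insert x (K : Set F).toFinset).val ⊆
      (Polynomial.X ^ Nat.card K - Polynomial.X : Polynomial F).roots := by
    intro y hy
    rw [Polynomial.mem_roots (FiniteField.X_pow_card_sub_X_ne_zero F hq), Polynomial.IsRoot,
      Polynomial.eval_sub, Polynomial.eval_pow, Polynomial.eval_X, sub_eq_zero]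
    rcases Finset.mem_insert.mp hy with rfl | hyK
    · exact hx
    · have hyK : y ∈ K := by simpa using hyK
      have := Fintype.ofFinite K
      rw [Nat.card_eq_fintype_card]
      exact congrArg Subtype.val (FiniteField.pow_card (⟨y, hyK⟩ : K))
  have hle := Polynomial.card_le_degree_of_subset_roots hroots
  rw [FiniteField.X_pow_card_sub_X_natDegree_eq F hq,
    Finset.card_insert_of_notMem (by simpa using hxK), ← Set.ncard_eq_toFinset_card',
    ← Nat.card_coe_set_eq] at hle
  exact Nat.not_succ_le_self _ hle

/-- The alternate representation is injective: if `ψ(α^(-i)·x) = 0` for all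
`0 ≤ i < N` with `N = (p^r-1)/(p^m-1)`, then `x = 0`. -/
theorem stmt_11 (p r m : ℕ) (hp : p.Prime) (F : Type*) [Field F] [Fintype F]
    (hF : Fintype.card F = p ^ r) (α : F)
    (hα : ∀ x : F, x ≠ 0 → ∃ k : ℕ, x = α ^ k)
    (hm : 0 < m) (hmr : m ∣ r)
    (K : Subfield F) (hK : Nat.card K = p ^ m)
    (ψ : F →ₗ[K] K) (hψ : Function.Surjective ψ) :
    ∀ x : F, (∀ i : ℕ, i < (p ^ r - 1) / (p ^ m - 1) → ψ (α⁻¹ ^ i * x) = 0) →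
      x = 0 := by
  intro x h
  have hdvd : p ^ m - 1 ∣ p ^ r - 1 := by
    obtain ⟨d, rfl⟩ := hmr
    rw [pow_mul]
    simpa only [one_pow] using Nat.sub_dvd_pow_sub_pow (p ^ m) 1 d
  have hr : 1 < p ^ r := hF ▸ Fintype.one_lt_card
  have hq : 1 < p ^ m := Nat.one_lt_pow hm.ne' hp.one_lt
  set N := (p ^ r - 1) / (p ^ m - 1)
  have hN : N * (p ^ m - 1) = p ^ r - 1 := Nat.div_mul_cancel hdvd
  have hNpos : 0 < N := Nat.pos_of_ne_zero fun h0 => by rw [h0] at hN; omega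
  have hmem : α⁻¹ ^ N ∈ K := by
    apply K.mem_of_pow_card_eq_self
    rw [hK]
    by_cases h0 : α⁻¹ = 0
    · simp [h0, hNpos.ne', hp.ne_zero]
    · have h1 : (α⁻¹ ^ N) ^ (p ^ m - 1) = 1 := by
        rw [← pow_mul, hN, ← hF, FiniteField.pow_card_sub_one_eq_one _ h0]
      rw [← Nat.sub_add_cancel hq.le, pow_succ, h1, one_mul]
  have hzero (y : F) : ψ (y * x) = 0 := by
    by_cases hy : y = 0
    · simp [hy]
    obtain ⟨k, hk⟩ := hα y⁻¹ (inv_ne_zero hy)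
    have hyk : y * x = (⟨α⁻¹ ^ N, hmem⟩ ^ (k / N) : K) • (α⁻¹ ^ (k % N) * x) := by
      rw [Subfield.smul_def, smul_eq_mul, ← mul_assoc, SubmonoidClass.coe_pow, ← pow_mul,
        ← pow_add, Nat.div_add_mod, inv_pow, ← hk, inv_inv]
    rw [hyk, map_smul, h _ (Nat.mod_lt _ hNpos), smul_zero]
  by_contra hx
  obtain ⟨z, hz⟩ := hψ 1
  have := hzero (z * x⁻¹)
  rw [inv_mul_cancel_right₀ hx, hz] at this
  exact one_ne_zero this
end

section
/- Let p be a prime, F a finite field with exactly p^r elements, α a primitive element of F, K a subfield of F with exactly p^m elements (m a divisor of r), and ψ : F → K a surjective K-linear map. Set N = (p^r − 1)/(p^m − 1). Then the image of the K-linear map from F to K^N sending x to (ψ(α^(−i)·x))_{0 ≤ i < N} is a K-subspace of K^N of dimension r/m. (The alternate representation vectors form an (N, r/m) linear code over K.) -/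
set_option synthInstance.maxHeartbeats 1000000

open Polynomial in
/-- In a field, the fixed points of `x ↦ x ^ #K` lie in the finite subfield `K`. -/
theorem Subfield.mem_of_pow_natCard_eq_self {F : Type*} [Field F] (K : Subfield F) [Finite K]
    {x : F} (hx : x ^ Nat.card K = x) : x ∈ K := by
  have := Fintype.ofFinite K
  rw [Nat.card_eq_fintype_card] at hx
  have hsplit : (X ^ Fintype.card K - X : K[X]).Splits := by
    simpa using (FiniteField.isSplittingField_sub K K).splits
  have hroot : x ∈ ((X ^ Fintype.card K - X : K[X]).map K.subtype).roots := by
    have hne := FiniteField.X_pow_card_sub_X_ne_zero F (Fintype.one_lt_card (α := K))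
    simpa [hne, sub_eq_zero] using hx
  rw [hsplit.roots_map] at hroot
  obtain ⟨y, -, rfl⟩ := Multiset.mem_map.1 hroot
  exact y.2

/-- A linear functional on a field that vanishes on the first `N` powers of a generator `β`
multiplied by `x` is zero, if `β ^ N` is a scalar. -/
theorem LinearMap.eq_zero_of_apply_pow_mul_eq_zero {F : Type*} [Field F] {K : Subfield F}
    (ψ : F →ₗ[K] K) {β : F} (hβ : ∀ y : F, y ≠ 0 → ∃ k : ℕ, y = β ^ k) {N : ℕ} (hN : 0 < N)
    (hβN : β ^ N ∈ K) {x : F} (hx : x ≠ 0) (h : ∀ i < N, ψ (β ^ i * x) = 0) : ψ = 0 := by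
  ext z
  by_cases hz : z = 0
  · simp [hz]
  obtain ⟨k, hk⟩ := hβ (z / x) (div_ne_zero hz hx)
  have hzk : z = (⟨β ^ N, hβN⟩ : K) ^ (k / N) • (β ^ (k % N) * x) := by
    rw [Subfield.smul_def, SubmonoidClass.coe_pow, smul_eq_mul, ← mul_assoc, ← pow_mul, ← pow_add,
      Nat.div_add_mod, ← hk, div_mul_cancel₀ _ hx]
  rw [hzk, map_smul, h _ (Nat.mod_lt _ hN), smul_zero]
  simp

/-- The alternate representation vectors form an `(N, r/m)` linear code over
`K`: the image of `x ↦ (ψ(α^(-i)·x))_{0 ≤ i < N}` is a `K`-subspace of `K^N`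
of dimension `r/m`. -/
theorem stmt_12 (p r m : ℕ) (hp : p.Prime) (F : Type*) [Field F] [Fintype F]
    (hF : Fintype.card F = p ^ r) (α : F)
    (hα : ∀ x : F, x ≠ 0 → ∃ k : ℕ, x = α ^ k)
    (hm : 0 < m) (hmr : m ∣ r)
    (K : Subfield F) (hK : Nat.card K = p ^ m)
    (ψ : F →ₗ[K] K) (hψ : Function.Surjective ψ)
    (Φ : F →ₗ[K] (Fin ((p ^ r - 1) / (p ^ m - 1)) → K))
    (hΦ : ∀ (x : F) (i : Fin ((p ^ r - 1) / (p ^ m - 1))),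
      Φ x i = ψ (α⁻¹ ^ (i : ℕ) * x)) :
    Module.finrank K (LinearMap.range Φ) = r / m := by
  have hcard : Nat.card F = p ^ r := by rw [Nat.card_eq_fintype_card, hF]
  have hq : 1 < p ^ m := Nat.one_lt_pow hm.ne' hp.one_lt
  have hr : 0 < r := by
    refine Nat.pos_of_ne_zero fun hr => ?_
    have := Fintype.one_lt_card (α := F)
    simp [hF, hr] at this
  have hdim : Module.finrank K F = r / m := by
    have h := Module.natCard_eq_pow_finrank (K := K) (V := F)
    rw [hcard, hK, ← pow_mul] at h
    rw [Nat.pow_right_injective hp.two_le h, Nat.mul_div_cancel_left _ hm]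
  have hdvd : p ^ m - 1 ∣ p ^ r - 1 := Nat.pow_sub_one_dvd_pow_sub_one p hmr
  have hle : p ^ m ≤ p ^ r := Nat.pow_le_pow_right hp.pos (Nat.le_of_dvd hr hmr)
  have hNmul := Nat.div_mul_cancel hdvd
  have hN : 0 < (p ^ r - 1) / (p ^ m - 1) := Nat.div_pos (by omega) (by omega)
  generalize (p ^ r - 1) / (p ^ m - 1) = N at Φ hΦ hNmul hN ⊢
  have hβ : ∀ y : F, y ≠ 0 → ∃ k : ℕ, y = α⁻¹ ^ k := fun y hy => by
    obtain ⟨k, hk⟩ := hα y⁻¹ (inv_ne_zero hy)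
    exact ⟨k, by rw [inv_pow, ← hk, inv_inv]⟩
  have hβN : α⁻¹ ^ N ∈ K := by
    refine K.mem_of_pow_natCard_eq_self ?_
    have hexp : N * p ^ m = p ^ r + (N - 1) := by
      rw [Nat.mul_sub_one] at hNmul
      have := Nat.le_mul_of_pos_right N (show 0 < p ^ m by omega)
      omega
    rw [hK, ← pow_mul, hexp, pow_add, ← hF, FiniteField.pow_card, ← pow_succ',
      Nat.sub_add_cancel hN]
  have hinj : Function.Injective Φ := by
    rw [injective_iff_map_eq_zero]
    intro x hx
    by_contra hx0
    have hψ0 : ψ = 0 := ψ.eq_zero_of_apply_pow_mul_eq_zero hβ hN hβN hx0 fun i hi => by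
      rw [← hΦ x ⟨i, hi⟩, hx, Pi.zero_apply]
    obtain ⟨y, hy⟩ := hψ 1
    simp [hψ0] at hy
  rw [LinearMap.finrank_range_of_inj hinj, hdim]
end
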